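/- arXiv:1912.05661 — 3 statements merged into one kernel-verified Lean document; each statement's English description precedes it below -/
import Mathlib

section
/- Let k ≥ 2 be a natural number, let σ, γ, λ, ψ be real numbers, and let x, y : ZMod k → ℝ be injective with x 0 = 0 and y 0 = 0. Set m* = min over i ≠ 0 of |x i| and n* = min over j ≠ 0 of |y j|, and let L = (1 + (k-1)·Real.exp (-σ^2 * m*^2)) * (1 + (k-1)·Real.exp (-σ^2 * γ^2 * n*^2)). Then the 2D circular convolution operator whose kernel is the sampled Gabor filter is L-Lipschitz in the ℓ² norm: for all I : ZMod k → ZMod k → ℂ, (∑ a, ∑ b, ‖∑ i, ∑ j, (G (x i) (y j) : ℂ) * I (a - i) (b - j)‖^2) ≤ L^2 * (∑ a, ∑ b, ‖I a b‖^2). -/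
/-- Young's inequality for convolution on a finite abelian group, in the case `ℓ¹ * ℓ² ⊆ ℓ²`. -/
theorem sum_norm_sq_conv_le {A : Type*} [AddCommGroup A] [Fintype A] (M I : A → ℂ) :
    ∑ a, ‖∑ g, M g * I (a - g)‖ ^ 2 ≤ (∑ g, ‖M g‖) ^ 2 * ∑ a, ‖I a‖ ^ 2 := by
  have cauchy_schwarz (a : A) : ‖∑ g, M g * I (a - g)‖ ^ 2 ≤
      (∑ g, ‖M g‖) * ∑ g, ‖M g‖ * ‖I (a - g)‖ ^ 2 := by
    calc ‖∑ g, M g * I (a - g)‖ ^ 2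
        ≤ (∑ g, ‖M g‖ * ‖I (a - g)‖) ^ 2 := by
          gcongr
          exact (norm_sum_le _ _).trans_eq (by simp only [norm_mul])
      _ ≤ _ := Finset.sum_sq_le_sum_mul_sum_of_sq_le_mul _ (fun _ _ => by positivity)
          (fun _ _ => by positivity) (fun _ _ => by apply le_of_eq; ring)
  calc ∑ a, ‖∑ g, M g * I (a - g)‖ ^ 2
      ≤ ∑ a, (∑ g, ‖M g‖) * ∑ g, ‖M g‖ * ‖I (a - g)‖ ^ 2 :=
        Finset.sum_le_sum fun a _ => cauchy_schwarz a
    _ = (∑ g, ‖M g‖) * ∑ g, ‖M g‖ * ∑ a, ‖I (a - g)‖ ^ 2 := by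
        rw [← Finset.mul_sum, Finset.sum_comm]
        simp only [Finset.mul_sum]
    _ = (∑ g, ‖M g‖) * ∑ g, ‖M g‖ * ∑ a, ‖I a‖ ^ 2 := by
        congr! 3 with g
        exact (Equiv.subRight g).sum_comp fun a => ‖I a‖ ^ 2
    _ = _ := by rw [← Finset.sum_mul]; ring

theorem sum_le_one_add_card_sub_one_mul {ι : Type*} [Fintype ι] (i₀ : ι) (w : ι → ℝ) (t : ℝ)
    (h₀ : w i₀ ≤ 1) (h : ∀ i, i ≠ i₀ → w i ≤ t) :
    ∑ i, w i ≤ 1 + (Fintype.card ι - 1 : ℝ) * t := by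
  classical
  rw [← Finset.add_sum_erase _ _ (Finset.mem_univ i₀)]
  refine add_le_add h₀ ?_
  refine (Finset.sum_le_card_nsmul _ _ t fun i hi => h i (Finset.ne_of_mem_erase hi)).trans_eq ?_
  rw [Finset.card_erase_of_mem (Finset.mem_univ i₀), Finset.card_univ, nsmul_eq_mul,
    Nat.cast_pred (Fintype.card_pos_iff.mpr ⟨i₀⟩)]

/-- The mass of a sampled Gaussian, in terms of the sample point closest to the centre. -/
theorem sum_exp_neg_mul_sq_le (k : ℕ) [NeZero k] (c : ℝ) (hc : 0 ≤ c) (x : ZMod k → ℝ)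
    (hx0 : x 0 = 0) (m : ℝ) (hm : IsLeast {r : ℝ | ∃ i : ZMod k, i ≠ 0 ∧ r = |x i|} m) :
    ∑ i, Real.exp (-c * x i ^ 2) ≤ 1 + (k - 1 : ℝ) * Real.exp (-c * m ^ 2) := by
  have hm0 : 0 ≤ m := by
    obtain ⟨i, -, rfl⟩ := hm.1
    exact abs_nonneg _
  have key := sum_le_one_add_card_sub_one_mul (0 : ZMod k) (fun i => Real.exp (-c * x i ^ 2))
    (Real.exp (-c * m ^ 2)) (by simp [hx0]) fun i hi => by
      have hle : m ^ 2 ≤ x i ^ 2 := by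
        rw [← sq_abs (x i)]
        exact pow_le_pow_left₀ hm0 (hm.2 ⟨i, hi, rfl⟩) 2
      exact Real.exp_le_exp.mpr (mul_le_mul_of_nonpos_left hle (neg_nonpos.mpr hc))
  rwa [ZMod.card] at key


/-- The 2D circular convolution with a sampled Gabor filter is `L`-Lipschitz in the ℓ² norm,
where `L = (1 + (k-1) e^{-σ² m*²}) (1 + (k-1) e^{-σ² γ² n*²})`. -/
theorem gabor_conv2d_lipschitz (k : ℕ) [NeZero k] (hk : 2 ≤ k) (σ γ lam ψ : ℝ)
    (x y : ZMod k → ℝ) (hx : Function.Injective x) (hy : Function.Injective y)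
    (hx0 : x 0 = 0) (hy0 : y 0 = 0)
    (mstar nstar : ℝ)
    (hm : IsLeast {r : ℝ | ∃ i : ZMod k, i ≠ 0 ∧ r = |x i|} mstar)
    (hn : IsLeast {r : ℝ | ∃ j : ZMod k, j ≠ 0 ∧ r = |y j|} nstar)
    (L : ℝ)
    (hL : L = (1 + (k - 1 : ℝ) * Real.exp (-σ ^ 2 * mstar ^ 2)) *
              (1 + (k - 1 : ℝ) * Real.exp (-σ ^ 2 * γ ^ 2 * nstar ^ 2)))
    (I : ZMod k → ZMod k → ℂ) :
    (∑ a : ZMod k, ∑ b : ZMod k,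
        ‖∑ i : ZMod k, ∑ j : ZMod k,
            ((Real.exp (-σ ^ 2 * ((x i) ^ 2 + γ ^ 2 * (y j) ^ 2)) *
                Real.cos (lam * x i + ψ) : ℝ) : ℂ) * I (a - i) (b - j)‖ ^ 2)
      ≤ L ^ 2 * (∑ a : ZMod k, ∑ b : ZMod k, ‖I a b‖ ^ 2) := by
  have young := sum_norm_sq_conv_le
    (fun p : ZMod k × ZMod k =>
      ((Real.exp (-σ ^ 2 * ((x p.1) ^ 2 + γ ^ 2 * (y p.2) ^ 2)) *
        Real.cos (lam * x p.1 + ψ) : ℝ) : ℂ))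
    (fun p => I p.1 p.2)
  simp only [Fintype.sum_prod_type, Prod.fst_sub, Prod.snd_sub] at young
  refine young.trans ?_
  gcongr
  calc ∑ i, ∑ j, ‖((Real.exp (-σ ^ 2 * ((x i) ^ 2 + γ ^ 2 * (y j) ^ 2)) *
          Real.cos (lam * x i + ψ) : ℝ) : ℂ)‖
      ≤ ∑ i, ∑ j, Real.exp (-σ ^ 2 * x i ^ 2) * Real.exp (-(σ ^ 2 * γ ^ 2) * y j ^ 2) := by
        refine Finset.sum_le_sum fun i _ => Finset.sum_le_sum fun j _ => ?_
        rw [Complex.norm_real, norm_mul, Real.norm_eq_abs, Real.abs_exp, ← Real.exp_add,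
          Real.norm_eq_abs]
        refine (mul_le_of_le_one_right (Real.exp_pos _).le (Real.abs_cos_le_one _)).trans_eq ?_
        ring_nf
    _ = (∑ i, Real.exp (-σ ^ 2 * x i ^ 2)) *
          ∑ j, Real.exp (-(σ ^ 2 * γ ^ 2) * y j ^ 2) := Finset.sum_mul_sum _ _ _ _ |>.symm
    _ ≤ L := by
        have hX := sum_exp_neg_mul_sq_le k (σ ^ 2) (by positivity) x hx0 mstar hm
        have hY := sum_exp_neg_mul_sq_le k (σ ^ 2 * γ ^ 2) (by positivity) y hy0 nstar hn
        rw [hL, neg_mul (σ ^ 2) (γ ^ 2)]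
        exact mul_le_mul hX hY (by positivity)
          ((Finset.sum_nonneg fun _ _ => (Real.exp_pos _).le).trans hX)
end

section
/- Let k ≥ 2 be a natural number, let σ, γ, λ, ψ be real numbers, and let x, y : ZMod k → ℝ be injective with x 0 = 0 and y 0 = 0. Set m* = min over i ≠ 0 of |x i| and n* = min over j ≠ 0 of |y j|. Then for every pair of frequencies u, v ∈ ZMod k, the magnitude of the 2D discrete Fourier transform of the sampled Gabor filter satisfies ‖∑ i, ∑ j, Complex.exp (-2 * π * Complex.I * (u.val * i.val + v.val * j.val) / k) * (G (x i) (y j) : ℂ)‖ ≤ (1 + (k-1)·Real.exp (-σ^2 * m*^2)) * (1 + (k-1)·Real.exp (-σ^2 * γ^2 * n*^2)). -/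
/-- A sum of Gaussian samples that contains the origin is at most one plus the number of remaining
samples times the value at the sample closest to the origin. -/
theorem sum_exp_neg_mul_sq_le_s1 {ι : Type*} [Fintype ι] (o : ι) (z : ι → ℝ) (ho : z o = 0)
    {c r : ℝ} (hc : 0 ≤ c) (hr : IsLeast {s : ℝ | ∃ i : ι, i ≠ o ∧ s = |z i|} r) :
    ∑ i, Real.exp (-c * z i ^ 2) ≤ 1 + (Fintype.card ι - 1 : ℝ) * Real.exp (-c * r ^ 2) := by
  classical
  have hr0 : 0 ≤ r := by
    obtain ⟨i, -, rfl⟩ := hr.1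
    exact abs_nonneg _
  have hcard : ((Finset.univ.erase o).card : ℝ) = Fintype.card ι - 1 := by
    rw [Finset.cast_card_erase_of_mem (Finset.mem_univ o), Finset.card_univ]
  rw [← Finset.add_sum_erase _ _ (Finset.mem_univ o), ho, ← hcard, ← nsmul_eq_mul]
  refine add_le_add (by simp) (Finset.sum_le_card_nsmul _ _ _ fun i hi => ?_)
  have hri : r ≤ |z i| := hr.2 ⟨i, Finset.ne_of_mem_erase hi, rfl⟩
  have hsq : r ^ 2 ≤ z i ^ 2 := by
    rw [← sq_abs (z i)]
    gcongr
  refine Real.exp_le_exp.mpr ?_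
  nlinarith

/-- The Fourier kernel has modulus one and the cosine factor has modulus at most one, so each term
of the transform is dominated by its separable Gaussian envelope. -/
theorem norm_dft_kernel_mul_gabor_le (a b c d k σ γ s t φ : ℝ) :
    ‖Complex.exp (-2 * (Real.pi : ℂ) * Complex.I *
          ((a : ℂ) * (b : ℂ) + (c : ℂ) * (d : ℂ)) / (k : ℂ)) *
        ((Real.exp (-σ ^ 2 * (s ^ 2 + γ ^ 2 * t ^ 2)) * Real.cos φ : ℝ) : ℂ)‖
      ≤ Real.exp (-σ ^ 2 * s ^ 2) * Real.exp (-(σ ^ 2 * γ ^ 2) * t ^ 2) := by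
  have harg : -2 * (Real.pi : ℂ) * Complex.I *
      ((a : ℂ) * (b : ℂ) + (c : ℂ) * (d : ℂ)) / (k : ℂ) =
        ((-2 * Real.pi * (a * b + c * d) / k : ℝ) : ℂ) * Complex.I := by
    push_cast
    ring
  rw [norm_mul, harg, Complex.norm_exp_ofReal_mul_I, one_mul, Complex.norm_real, norm_mul,
    Real.norm_of_nonneg (Real.exp_pos _).le, ← Real.exp_add,
    show -σ ^ 2 * s ^ 2 + -(σ ^ 2 * γ ^ 2) * t ^ 2 = -σ ^ 2 * (s ^ 2 + γ ^ 2 * t ^ 2) by ring]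
  exact mul_le_of_le_one_right (Real.exp_pos _).le (Real.abs_cos_le_one φ)

/-- The magnitude of the 2D DFT of the sampled Gabor filter is bounded by
`(1 + (k-1) e^{-σ² m*²}) (1 + (k-1) e^{-σ² γ² n*²})`. -/
theorem gabor_dft2d_bound (k : ℕ) [NeZero k] (hk : 2 ≤ k) (σ γ lam ψ : ℝ)
    (x y : ZMod k → ℝ) (hx : Function.Injective x) (hy : Function.Injective y)
    (hx0 : x 0 = 0) (hy0 : y 0 = 0)
    (mstar nstar : ℝ)
    (hm : IsLeast {r : ℝ | ∃ i : ZMod k, i ≠ 0 ∧ r = |x i|} mstar)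
    (hn : IsLeast {r : ℝ | ∃ j : ZMod k, j ≠ 0 ∧ r = |y j|} nstar)
    (u v : ZMod k) :
    ‖∑ i : ZMod k, ∑ j : ZMod k,
        Complex.exp (-2 * (Real.pi : ℂ) * Complex.I *
            ((u.val : ℂ) * (i.val : ℂ) + (v.val : ℂ) * (j.val : ℂ)) / (k : ℂ)) *
          ((Real.exp (-σ ^ 2 * ((x i) ^ 2 + γ ^ 2 * (y j) ^ 2)) *
              Real.cos (lam * x i + ψ) : ℝ) : ℂ)‖
      ≤ (1 + (k - 1 : ℝ) * Real.exp (-σ ^ 2 * mstar ^ 2)) *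
          (1 + (k - 1 : ℝ) * Real.exp (-σ ^ 2 * γ ^ 2 * nstar ^ 2)) := by
  have hX := sum_exp_neg_mul_sq_le_s1 0 x hx0 (sq_nonneg σ) hm
  have hY := sum_exp_neg_mul_sq_le_s1 0 y hy0 (by positivity : 0 ≤ σ ^ 2 * γ ^ 2) hn
  rw [ZMod.card] at hX hY
  rw [neg_mul (σ ^ 2) (γ ^ 2)]
  calc
    _ ≤ ∑ i : ZMod k, ∑ j : ZMod k,
          Real.exp (-σ ^ 2 * x i ^ 2) * Real.exp (-(σ ^ 2 * γ ^ 2) * y j ^ 2) :=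
      norm_sum_le_of_le _ fun i _ => norm_sum_le_of_le _ fun j _ => by
        exact_mod_cast norm_dft_kernel_mul_gabor_le u.val i.val v.val j.val k σ γ (x i) (y j)
          (lam * x i + ψ)
    _ = (∑ i : ZMod k, Real.exp (-σ ^ 2 * x i ^ 2)) *
          ∑ j : ZMod k, Real.exp (-(σ ^ 2 * γ ^ 2) * y j ^ 2) :=
      (Finset.sum_mul_sum _ _ _ _).symm
    _ ≤ _ := mul_le_mul hX hY (by positivity) ((Finset.sum_nonneg fun _ _ => by positivity).trans hX)
end

section
/- Let k ≥ 2 be a natural number, let σ, λ, ψ be real numbers, and let x : ZMod k → ℝ be injective with x 0 = 0. Set m* = min over i ≠ 0 of |x i| and define the kernel h : ZMod k → ℂ by h i = ((Real.exp (-σ^2 * (x i)^2) * Real.cos (λ * x i + ψ)) : ℂ). Then for every I : ZMod k → ℂ, ∑ a, ‖∑ i, h i * I (a - i)‖^2 ≤ (1 + (k-1)·Real.exp (-σ^2 * m*^2))^2 * ∑ a, ‖I a‖^2; that is, circular convolution with the sampled one-dimensional Gabor kernel is Lipschitz in the ℓ² norm with constant 1 + (k-1)·Real.exp (-σ^2 *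 m*^2). -/
/-- Young's inequality `ℓ¹ * ℓ² ⊆ ℓ²` for the convolution on a finite additive group. -/
theorem sum_norm_sq_convolution_le {G R : Type*} [AddGroup G] [Fintype G]
    [SeminormedRing R] (h f : G → R) :
    ∑ a, ‖∑ i, h i * f (a - i)‖ ^ 2 ≤ (∑ i, ‖h i‖) ^ 2 * ∑ a, ‖f a‖ ^ 2 := by
  have pointwise (a : G) : ‖∑ i, h i * f (a - i)‖ ^ 2
      ≤ (∑ i, ‖h i‖) * ∑ i, ‖h i‖ * ‖f (a - i)‖ ^ 2 := by
    calc ‖∑ i, h i * f (a - i)‖ ^ 2 ≤ (∑ i, ‖h i‖ * ‖f (a - i)‖) ^ 2 := by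
          gcongr
          exact norm_sum_le_of_le _ fun i _ => norm_mul_le _ _
      _ ≤ _ := Finset.sum_sq_le_sum_mul_sum_of_sq_le_mul _ (fun i _ => by positivity)
          (fun i _ => by positivity) fun i _ => (by ring : _ = _).le
  calc ∑ a, ‖∑ i, h i * f (a - i)‖ ^ 2
      ≤ ∑ a, (∑ i, ‖h i‖) * ∑ i, ‖h i‖ * ‖f (a - i)‖ ^ 2 :=
        Finset.sum_le_sum fun a _ => pointwise a
    _ = (∑ i, ‖h i‖) * ∑ i, ‖h i‖ * ∑ a, ‖f (a - i)‖ ^ 2 := by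
        rw [← Finset.mul_sum, Finset.sum_comm]
        simp only [Finset.mul_sum]
    _ = (∑ i, ‖h i‖) ^ 2 * ∑ a, ‖f a‖ ^ 2 := by
        have shift (i : G) : ∑ a, ‖f (a - i)‖ ^ 2 = ∑ a, ‖f a‖ ^ 2 :=
          (Equiv.subRight i).sum_comp fun a => ‖f a‖ ^ 2
        simp only [shift, ← Finset.sum_mul]
        ring


/-- Circular convolution with the sampled one-dimensional Gabor kernel is Lipschitz in the ℓ²
norm with constant `1 + (k-1) e^{-σ² m*²}`. -/
theorem gabor_conv1d_lipschitz (k : ℕ) [NeZero k] (hk : 2 ≤ k) (σ lam ψ : ℝ)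
    (x : ZMod k → ℝ) (hx : Function.Injective x) (hx0 : x 0 = 0)
    (mstar : ℝ)
    (hm : IsLeast {r : ℝ | ∃ i : ZMod k, i ≠ 0 ∧ r = |x i|} mstar)
    (h : ZMod k → ℂ)
    (hdef : ∀ i : ZMod k,
      h i = ((Real.exp (-σ ^ 2 * (x i) ^ 2) * Real.cos (lam * x i + ψ) : ℝ) : ℂ))
    (I : ZMod k → ℂ) :
    ∑ a : ZMod k, ‖∑ i : ZMod k, h i * I (a - i)‖ ^ 2
      ≤ (1 + (k - 1 : ℝ) * Real.exp (-σ ^ 2 * mstar ^ 2)) ^ 2 *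
          ∑ a : ZMod k, ‖I a‖ ^ 2 := by
  have norm_le (i : ZMod k) : ‖h i‖ ≤ Real.exp (-σ ^ 2 * (x i) ^ 2) := by
    rw [hdef, Complex.norm_real, norm_mul, Real.norm_eq_abs, Real.norm_eq_abs, Real.abs_exp]
    exact mul_le_of_le_one_right (Real.exp_nonneg _) (Real.abs_cos_le_one _)
  obtain ⟨j, -, rfl⟩ := hm.1
  have norm_le_of_ne (i : ZMod k) (hi : i ≠ 0) : ‖h i‖ ≤ Real.exp (-σ ^ 2 * |x j| ^ 2) := by
    refine (norm_le i).trans (Real.exp_le_exp.2 ?_)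
    have hji : |x j| ^ 2 ≤ x i ^ 2 :=
      sq_le_sq.2 (by simpa only [abs_abs] using hm.2 ⟨i, hi, rfl⟩)
    exact mul_le_mul_of_nonpos_left hji (neg_nonpos.2 (sq_nonneg σ))
  have sum_le : ∑ i, ‖h i‖ ≤ 1 + (k - 1 : ℝ) * Real.exp (-σ ^ 2 * |x j| ^ 2) := by
    rw [← Finset.add_sum_erase _ _ (Finset.mem_univ (0 : ZMod k))]
    refine add_le_add (by simpa [hx0] using norm_le 0) ?_
    refine (Finset.sum_le_card_nsmul _ _ _ fun i hi =>
      norm_le_of_ne i (Finset.ne_of_mem_erase hi)).trans_eq ?_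
    rw [Finset.card_erase_of_mem (Finset.mem_univ _), Finset.card_univ, ZMod.card, nsmul_eq_mul,
      Nat.cast_sub (by lia), Nat.cast_one]
  refine (sum_norm_sq_convolution_le h I).trans ?_
  gcongr
end
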